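/- arXiv:2502.10960 — 2 statements merged into one kernel-verified Lean document; each statement's English description precedes it below -/
import Mathlib

section
/- There exist a constant C₂ > 0 and a function M : ℤ → (0,∞) with Σ_{k∈ℤ} π(k) M(k) < ∞ such that for every j ∈ ℤ and every n ≥ 1, Σ_{k∈ℤ} | P_j(𝔇_{β_n} = k) − π(k) | ≤ M(j) e^{−C₂ n}. -/
open MeasureTheory Filter ProbabilityTheory

noncomputable section

/-- One-step transition probability of the urn discrepancy chain with parameter `lam`:
from state `i`, jump to `i+1` with probability `lam^(2i-1)/(1+lam^(2i-1))` and to `i-1`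
with probability `1/(1+lam^(2i-1))`. -/
def urnStep (lam : ℝ) (i j : ℤ) : ℝ :=
  if j = i + 1 then lam ^ (2 * i - 1) / (1 + lam ^ (2 * i - 1))
  else if j = i - 1 then 1 / (1 + lam ^ (2 * i - 1))
  else 0

/-- `P` is the family of laws (indexed by the starting point) of the urn discrepancy
chain with parameter `lam`, characterized by its cylinder probabilities. -/
def IsUrnChain (lam : ℝ) (P : ℤ → Measure (ℕ → ℤ)) : Prop :=
  (∀ x, IsProbabilityMeasure (P x)) ∧
    ∀ (x : ℤ) (n : ℕ) (p : ℕ → ℤ),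
      (P x {ω | ∀ i ≤ n, ω i = p i}).toReal =
        (if p 0 = x then (1 : ℝ) else 0) *
          ∏ i ∈ Finset.range n, urnStep lam (p i) (p (i + 1))

/-- Number of down-steps of the path `ω` during the time interval `[1, j]`. -/
def downCount (ω : ℕ → ℤ) (j : ℕ) : ℕ :=
  ((Finset.Icc 1 j).filter fun ℓ => ω ℓ = ω (ℓ - 1) - 1).card

/-- `betaTime ω i` is the time of the `i`-th down-step of the path `ω`. -/
def betaTime (ω : ℕ → ℤ) (i : ℕ) : ℕ :=
  sInf {j | 1 ≤ j ∧ downCount ω j = i}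

/-- The probability distribution `π(x) = lam^(x²) / Σ_y lam^(y²)` on `ℤ`. -/
def urnPi (lam : ℝ) (x : ℤ) : ℝ :=
  lam ^ (x ^ 2) / ∑' y : ℤ, lam ^ (y ^ 2)

/-- The ratio of the up-probability to the down-probability of the chain at `x`. -/
def urnRatio (lam : ℝ) (x : ℤ) : ℝ := lam ^ (2 * x - 1)

lemma urnRatio_pos {lam : ℝ} (h0 : 0 < lam) (x : ℤ) : 0 < urnRatio lam x := zpow_pos h0 _

lemma urnRatio_succ {lam : ℝ} (h0 : 0 < lam) (x : ℤ) :
    urnRatio lam (x + 1) = lam ^ 2 * urnRatio lam x := by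
  unfold urnRatio
  rw [← zpow_natCast lam 2, ← zpow_add₀ h0.ne']
  congr 1
  push_cast
  ring

lemma urnRatio_antitone {lam : ℝ} (h0 : 0 < lam) (h1 : lam < 1) : Antitone (urnRatio lam) :=
  fun x y hxy => zpow_le_zpow_right_of_le_one₀ h0 h1.le (by omega)

/-- A strictly increasing function on `ℤ` whose induced metric is contracted by the transition
operator of the chain observed at its down-steps. -/
def urnPotential (lam : ℝ) (x : ℤ) : ℝ := x + lam ^ 3 / (1 - lam ^ 2) * (lam ^ (2 * x))⁻¹

lemma urnPotential_succ_sub {lam : ℝ} (h0 : 0 < lam) (h1 : lam < 1) (x : ℤ) :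
    urnPotential lam (x + 1) - urnPotential lam x = 1 + (urnRatio lam x)⁻¹ := by
  have h2 : (1 - lam ^ 2) ≠ 0 := by nlinarith
  have e1 : lam ^ (2 * (x + 1)) = lam ^ 2 * lam ^ (2 * x) := by
    rw [← zpow_natCast lam 2, ← zpow_add₀ h0.ne']
    congr 1
    push_cast
    ring
  have e2 : lam ^ (2 * x - 1) = lam ^ (2 * x) / lam := zpow_sub_one₀ h0.ne' _
  have h3 : lam ^ (2 * x) ≠ 0 := (zpow_pos h0 _).ne'
  unfold urnPotential urnRatio
  rw [e1, e2]
  push_cast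
  field_simp
  ring

lemma summable_abs_mul_zpow_sq {lam : ℝ} (h0 : 0 < lam) (h1 : lam < 1) (k : ℕ) (s : ℝ) :
    Summable fun x : ℤ => lam ^ (x ^ 2) * (|(x : ℝ)| ^ k * Real.exp (s * |(x : ℝ)|)) := by
  have hT : 0 < -Real.log lam / Real.pi := div_pos (neg_pos.2 (Real.log_neg h0 h1)) Real.pi_pos
  refine (summable_pow_mul_jacobiTheta₂_term_bound (s / (2 * Real.pi)) hT k).congr fun x => ?_
  have e : lam ^ (x ^ 2) = Real.exp (Real.log lam * (x : ℝ) ^ 2) := by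
    rw [← Real.rpow_intCast, Real.rpow_def_of_pos h0]
    push_cast
    rfl
  rw [e, mul_left_comm, ← Real.exp_add]
  push_cast
  congr 2
  have := Real.pi_pos.ne'
  field_simp
  ring

lemma summable_zpow_sq {lam : ℝ} (h0 : 0 < lam) (h1 : lam < 1) :
    Summable fun x : ℤ => lam ^ (x ^ 2) := by
  simpa using summable_abs_mul_zpow_sq h0 h1 0 0

lemma summable_zpow_sq_mul_abs_urnPotential {lam : ℝ} (h0 : 0 < lam) (h1 : lam < 1) :
    Summable fun x : ℤ => lam ^ (x ^ 2) * |urnPotential lam x| := by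
  have hk : 0 ≤ lam ^ 3 / (1 - lam ^ 2) := div_nonneg (by positivity) (by nlinarith)
  have hlog := Real.log_neg h0 h1
  refine Summable.of_nonneg_of_le (fun x => by positivity) (fun x => ?_)
    ((summable_abs_mul_zpow_sq h0 h1 1 0).add
      ((summable_abs_mul_zpow_sq h0 h1 0 (-2 * Real.log lam)).mul_left (lam ^ 3 / (1 - lam ^ 2))))
  have hb : (lam ^ (2 * x))⁻¹ ≤ Real.exp (-2 * Real.log lam * |(x : ℝ)|) := by
    rw [← Real.rpow_intCast, Real.rpow_def_of_pos h0, ← Real.exp_neg, Real.exp_le_exp]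
    push_cast
    nlinarith [le_abs_self (x : ℝ)]
  have : |urnPotential lam x| ≤ |(x : ℝ)| + lam ^ 3 / (1 - lam ^ 2) *
      Real.exp (-2 * Real.log lam * |(x : ℝ)|) := by
    refine (abs_add_le _ _).trans (add_le_add le_rfl ?_)
    rw [abs_of_nonneg (mul_nonneg hk (inv_nonneg.2 (zpow_nonneg h0.le _)))]
    exact mul_le_mul_of_nonneg_left hb hk
  calc _ ≤ _ := mul_le_mul_of_nonneg_left this (zpow_nonneg h0.le _)
    _ = _ := by simp; ring

lemma tsum_zpow_sq_pos {lam : ℝ} (h0 : 0 < lam) (h1 : lam < 1) :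
    0 < ∑' y : ℤ, lam ^ (y ^ 2) :=
  (summable_zpow_sq h0 h1).tsum_pos (fun _ => zpow_nonneg h0.le _) 0 (zpow_pos h0 _)

lemma urnPi_pos {lam : ℝ} (h0 : 0 < lam) (h1 : lam < 1) (x : ℤ) : 0 < urnPi lam x :=
  div_pos (zpow_pos h0 _) (tsum_zpow_sq_pos h0 h1)

lemma hasSum_urnPi {lam : ℝ} (h0 : 0 < lam) (h1 : lam < 1) : HasSum (urnPi lam) 1 := by
  have := (summable_zpow_sq h0 h1).hasSum.div_const (∑' y : ℤ, lam ^ (y ^ 2))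
  rwa [div_self (tsum_zpow_sq_pos h0 h1).ne'] at this

lemma summable_urnPi_mul_abs_urnPotential {lam : ℝ} (h0 : 0 < lam) (h1 : lam < 1) :
    Summable fun x => urnPi lam x * |urnPotential lam x| := by
  refine ((summable_zpow_sq_mul_abs_urnPotential h0 h1).div_const
    (∑' y : ℤ, lam ^ (y ^ 2))).congr fun x => ?_
  rw [urnPi]
  ring

lemma urnPi_succ {lam : ℝ} (h0 : 0 < lam) (x : ℤ) :
    urnPi lam (x + 1) = urnRatio lam (x + 1) * urnPi lam x := by
  unfold urnPi urnRatio
  rw [mul_div_assoc', ← zpow_add₀ h0.ne']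
  congr 2
  ring

lemma summable_urnPi_mul {lam : ℝ} (h0 : 0 < lam) (h1 : lam < 1) {g : ℤ → ℝ} {B : ℝ}
    (hg : ∀ x, |g x| ≤ B) : Summable fun x => urnPi lam x * g x := by
  refine Summable.of_norm_bounded ((hasSum_urnPi h0 h1).summable.mul_right B) fun x => ?_
  rw [Real.norm_eq_abs, abs_mul, abs_of_pos (urnPi_pos h0 h1 x)]
  exact mul_le_mul_of_nonneg_left (hg x) (urnPi_pos h0 h1 x).le

/-- If `g` is obtained from `f` by one application of the transition operator of the chain observed
at its down-steps (in the form of the first-step equation), then `f` and `g` have the same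
`π`-average. -/
lemma tsum_urnPi_mul_eq_of_firstStep {lam : ℝ} (h0 : 0 < lam) (h1 : lam < 1) {f g : ℤ → ℝ} {B : ℝ}
    (hf : ∀ x, |f x| ≤ B) (hg : ∀ x, |g x| ≤ B)
    (h : ∀ x, (1 + urnRatio lam x) * g x = f (x - 1) + urnRatio lam x * g (x + 1)) :
    ∑' x, urnPi lam x * g x = ∑' x, urnPi lam x * f x := by
  have hsf := summable_urnPi_mul h0 h1 hf
  have hsg := summable_urnPi_mul h0 h1 hg
  have hs1 : Summable fun x => urnPi lam x * g (x + 1) :=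
    summable_urnPi_mul h0 h1 fun x => hg (x + 1)
  have e : ∀ x, urnPi lam x * g (x + 1) + urnPi lam (x + 1) * g (x + 1) =
      urnPi lam x * f x + urnPi lam (x + 1) * g (x + 1 + 1) := fun x => by
    have := h (x + 1)
    rw [add_sub_cancel_right] at this
    rw [urnPi_succ h0]
    linear_combination urnPi lam x * this
  have shift : ∀ F : ℤ → ℝ, ∑' x, F (x + 1) = ∑' x, F x := fun F =>
    (Equiv.addRight (1 : ℤ)).tsum_eq F
  have sshift : ∀ F : ℤ → ℝ, Summable F → Summable fun x => F (x + 1) := fun F hF =>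
    (Equiv.addRight (1 : ℤ)).summable_iff.2 hF
  have key := tsum_congr (L := .unconditional ℤ) e
  rw [hs1.tsum_add (sshift _ hsg), hsf.tsum_add (sshift _ hs1),
    shift fun x => urnPi lam x * g x, shift fun x => urnPi lam x * g (x + 1)] at key
  linarith

lemma nonpos_of_le_mul_succ {h c : ℤ → ℝ} {x₀ : ℤ} {C θ : ℝ} (hθ : θ < 1)
    (hc : ∀ x ≥ x₀, 0 ≤ c x ∧ c x ≤ θ) (hC : 0 ≤ C) (hle : ∀ x ≥ x₀, h x ≤ c x * h (x + 1))
    (hb : ∀ x ≥ x₀, h x ≤ C) : h x₀ ≤ 0 := by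
  have hθ0 : 0 ≤ θ := (hc x₀ le_rfl).1.trans (hc x₀ le_rfl).2
  have hn : ∀ n : ℕ, ∀ x ≥ x₀, h x ≤ C * θ ^ n := by
    intro n
    induction n with
    | zero => simpa using hb
    | succ n ih =>
      intro x hx
      calc h x ≤ c x * h (x + 1) := hle x hx
        _ ≤ c x * (C * θ ^ n) := mul_le_mul_of_nonneg_left (ih _ (by omega)) (hc x hx).1
        _ ≤ θ * (C * θ ^ n) := mul_le_mul_of_nonneg_right (hc x hx).2 (by positivity)
        _ = C * θ ^ (n + 1) := by ring
  have ht : Tendsto (fun n : ℕ => C * θ ^ n) atTop (nhds 0) := by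
    simpa using (tendsto_pow_atTop_nhds_zero_of_lt_one hθ0 hθ).const_mul C
  exact ge_of_tendsto' ht fun n => hn n x₀ le_rfl

/-- One application of the transition operator contracts the Lipschitz constant with respect to
`urnPotential` by the factor `(1 + lam ^ 2) / 2`. -/
lemma abs_succ_sub_le_of_firstStep {lam : ℝ} (h0 : 0 < lam) (h1 : lam < 1) {f g : ℤ → ℝ} {B L : ℝ}
    (hL : 0 ≤ L) (hg : ∀ x, |g x| ≤ B)
    (h : ∀ x, (1 + urnRatio lam x) * g x = f (x - 1) + urnRatio lam x * g (x + 1))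
    (hf : ∀ x, |f (x + 1) - f x| ≤ L * (1 + (urnRatio lam x)⁻¹)) (x : ℤ) :
    |g (x + 1) - g x| ≤ L * ((1 + lam ^ 2) / 2) * (1 + (urnRatio lam x)⁻¹) := by
  set r := urnRatio lam with hr
  have rpos : ∀ y, 0 < r y := urnRatio_pos h0
  have rsucc : ∀ y, r (y + 1) = lam ^ 2 * r y := urnRatio_succ h0
  have ranti : Antitone r := urnRatio_antitone h0 h1
  set ρ := (1 + lam ^ 2) / 2 with hρ
  set D : ℤ → ℝ := fun y => (1 + r y) * (g (y + 1) - g y) with hD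
  set U : ℤ → ℝ := fun y => L * ρ * ((1 + r y) * (1 + (r y)⁻¹)) with hU
  set c : ℤ → ℝ := fun y => r (y + 1) / (1 + r (y + 1)) with hc
  have hB : 0 ≤ B := (abs_nonneg _).trans (hg 0)
  have hc0 : ∀ y, 0 ≤ c y := fun y => div_nonneg (rpos _).le (by linarith [rpos (y + 1)])
  have hDrec : ∀ y, D y = (f (y - 1 + 1) - f (y - 1)) + c y * D (y + 1) := fun y => by
    have e1 := h y
    have e2 := h (y + 1)
    rw [add_sub_cancel_right] at e2
    have : (1 + r (y + 1)) ≠ 0 := by linarith [rpos (y + 1)]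
    simp only [hD, hc]
    rw [div_mul_eq_mul_div, mul_div_assoc, mul_div_cancel_left₀ _ this, sub_add_cancel]
    linear_combination e2 - e1
  have hUrec : ∀ y, L * (1 + (r (y - 1))⁻¹) + c y * U (y + 1) ≤ U y := fun y => by
    have ey : r y = lam ^ 2 * r (y - 1) := by rw [← rsucc, sub_add_cancel]
    have a0 := rpos y
    have e3 : (r (y - 1))⁻¹ = lam ^ 2 * (r y)⁻¹ := by
      rw [ey]
      have := (rpos (y - 1)).ne'
      field_simp
    have e4 : c y * U (y + 1) = L * ρ * (1 + lam ^ 2 * r y) := by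
      simp only [hc, hU]
      rw [← rsucc]
      have := rpos (y + 1)
      field_simp
      ring
    have e5 : (1 + r y) * (1 + (r y)⁻¹) = 2 + r y + (r y)⁻¹ := by
      field_simp
      ring
    simp only [hU] at e4 ⊢
    rw [e4, e3, e5]
    have hai : r y * (r y)⁻¹ = 1 := mul_inv_cancel₀ a0.ne'
    have hi : 0 < (r y)⁻¹ := inv_pos.2 a0
    have h2 : 2 ≤ r y + (r y)⁻¹ := by nlinarith [sq_nonneg (r y - (r y)⁻¹)]
    have hs : 0 ≤ (1 - lam ^ 2) := by nlinarith
    have : 0 ≤ L * ((1 - lam ^ 2) / 2 * ((r y)⁻¹ + (1 + lam ^ 2) * r y - 1)) := by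
      refine mul_nonneg hL (mul_nonneg (by linarith) ?_)
      nlinarith [mul_nonneg (sq_nonneg lam) a0.le]
    rw [hρ]
    nlinarith
  have hle : ∀ y, |D y| - U y ≤ c y * (|D (y + 1)| - U (y + 1)) := fun y => by
    have e1 : |D y| ≤ L * (1 + (r (y - 1))⁻¹) + c y * |D (y + 1)| := by
      rw [hDrec y]
      refine (abs_add_le _ _).trans (add_le_add (hf _) ?_)
      rw [abs_mul, abs_of_nonneg (hc0 y)]
    linarith [hUrec y, mul_sub (c y) (|D (y + 1)|) (U (y + 1))]
  have hU0 : ∀ y, 0 ≤ U y := fun y => by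
    have := rpos y
    positivity
  have main : |D x| - U x ≤ 0 := by
    refine nonpos_of_le_mul_succ (h := fun y => |D y| - U y) (c := c)
      (C := (1 + r x) * (2 * B)) (θ := r x / (1 + r x)) ?_ ?_ ?_ (fun y _ => hle y) ?_
    · rw [div_lt_one (by linarith [rpos x])]
      linarith
    · refine fun y hy => ⟨hc0 y, ?_⟩
      have := ranti (show x ≤ y + 1 by omega)
      have h3 := rpos x
      have h4 := rpos (y + 1)
      simp only [hc]
      rw [div_le_div_iff₀ (by linarith) (by linarith)]
      nlinarith
    · have := rpos x
      positivity
    · intro y hy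
      have h3 := ranti hy
      have h4 := rpos y
      have : |D y| ≤ (1 + r x) * (2 * B) := by
        simp only [hD]
        rw [abs_mul, abs_of_nonneg (by linarith)]
        refine mul_le_mul (by linarith) ?_ (abs_nonneg _) (by linarith)
        linarith [abs_sub (g (y + 1)) (g y), hg (y + 1), hg y]
      linarith [hU0 y]
  have hx := rpos x
  have : (1 + r x) * |g (x + 1) - g x| ≤ (1 + r x) * (L * ρ * (1 + (r x)⁻¹)) := by
    have e : |D x| = (1 + r x) * |g (x + 1) - g x| := by
      simp only [hD]
      rw [abs_mul, abs_of_nonneg (by linarith)]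
    rw [← e]
    simp only [hU] at main
    linarith
  exact le_of_mul_le_mul_left this (by linarith)

lemma abs_sub_le_of_abs_succ_sub_le {g V : ℤ → ℝ} (h : ∀ x, |g (x + 1) - g x| ≤ V (x + 1) - V x)
    (x y : ℤ) : |g x - g y| ≤ |V x| + |V y| := by
  have m1 : Monotone fun x => V x - g x :=
    monotone_int_of_le_succ fun x => by linarith [le_abs_self (g (x + 1) - g x), h x]
  have m2 : Monotone fun x => V x + g x :=
    monotone_int_of_le_succ fun x => by linarith [neg_abs_le (g (x + 1) - g x), h x]
  have hV : |g x - g y| ≤ |V x - V y| := by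
    rcases le_total x y with hxy | hxy
    · have a := m1 hxy
      have b := m2 hxy
      simp only at a b
      rw [abs_sub_comm (V x)]
      exact (abs_le.2 ⟨by linarith, by linarith⟩).trans (le_abs_self _)
    · have a := m1 hxy
      have b := m2 hxy
      simp only at a b
      exact (abs_le.2 ⟨by linarith, by linarith⟩).trans (le_abs_self _)
  exact hV.trans (abs_sub _ _)

/-- Geometric convergence to the `π`-average for the iterates of the transition operator of the
chain observed at its down-steps. -/
lemma abs_sub_tsum_urnPi_le {lam : ℝ} (h0 : 0 < lam) (h1 : lam < 1) {G : ℕ → ℤ → ℝ} {B L : ℝ}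
    (hL : 0 ≤ L) (hG : ∀ n x, |G n x| ≤ B)
    (h : ∀ n x, (1 + urnRatio lam x) * G (n + 1) x =
      G n (x - 1) + urnRatio lam x * G (n + 1) (x + 1))
    (hf : ∀ x, |G 0 (x + 1) - G 0 x| ≤ L) (n : ℕ) (j : ℤ) :
    |G n j - ∑' x, urnPi lam x * G 0 x| ≤ L * ((1 + lam ^ 2) / 2) ^ n *
      (|urnPotential lam j| + ∑' x, urnPi lam x * |urnPotential lam x|) := by
  set c := L * ((1 + lam ^ 2) / 2) ^ n with hc
  have hc0 : 0 ≤ c := by positivity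
  have inv : ∀ n, ∑' x, urnPi lam x * G n x = ∑' x, urnPi lam x * G 0 x := by
    intro n
    induction n with
    | zero => rfl
    | succ n ih => rw [← ih, tsum_urnPi_mul_eq_of_firstStep h0 h1 (hG n) (hG _) (h n)]
  have lip : ∀ n x, |G n (x + 1) - G n x| ≤
      L * ((1 + lam ^ 2) / 2) ^ n * (1 + (urnRatio lam x)⁻¹) := by
    intro n
    induction n with
    | zero =>
      intro x
      have := inv_pos.2 (urnRatio_pos h0 x)
      refine (hf x).trans ?_
      rw [pow_zero, mul_one]
      nlinarith
    | succ n ih =>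
      intro x
      rw [pow_succ, ← mul_assoc]
      exact abs_succ_sub_le_of_firstStep h0 h1 (by positivity) (hG _) (h n) ih x
  have osc : ∀ y, |G n j - G n y| ≤ c * (|urnPotential lam j| + |urnPotential lam y|) := fun y => by
    have := abs_sub_le_of_abs_succ_sub_le (g := G n) (V := fun x => c * urnPotential lam x)
      (fun x => by rw [← mul_sub, urnPotential_succ_sub h0 h1]; exact lip n x) j y
    rwa [abs_mul c, abs_mul c, abs_of_nonneg hc0, ← mul_add] at this
  have hπ := hasSum_urnPi h0 h1
  have s1 : HasSum (fun x => urnPi lam x * (G n j - G n x))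
      (G n j - ∑' x, urnPi lam x * G 0 x) := by
    have := (hπ.mul_right (G n j)).sub (summable_urnPi_mul h0 h1 (hG n)).hasSum
    rw [inv n, one_mul] at this
    exact this.congr_fun fun x => by ring
  have s2 : HasSum (fun x => c * (urnPi lam x * |urnPotential lam j| +
      urnPi lam x * |urnPotential lam x|))
      (c * (|urnPotential lam j| + ∑' x, urnPi lam x * |urnPotential lam x|)) := by
    have := ((hπ.mul_right |urnPotential lam j|).add
      (summable_urnPi_mul_abs_urnPotential h0 h1).hasSum).mul_left c
    rwa [one_mul] at this
  rw [← s1.tsum_eq, ← Real.norm_eq_abs]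
  refine tsum_of_norm_bounded s2 fun x => ?_
  have hx := urnPi_pos h0 h1 x
  rw [Real.norm_eq_abs, abs_mul, abs_of_pos hx]
  calc _ ≤ _ := mul_le_mul_of_nonneg_left (osc x) hx.le
    _ = _ := by ring

/-- The path `ω` preceded by the extra initial position `x`. -/
def pathCons (x : ℤ) (ω : ℕ → ℤ) : ℕ → ℤ
  | 0 => x
  | n + 1 => ω n

lemma measurable_pathCons (x : ℤ) : Measurable (pathCons x) := by
  refine measurable_pi_iff.2 fun n => ?_
  cases n with
  | zero => exact measurable_const
  | succ n => exact measurable_pi_apply n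

lemma downCount_eq_sum (ω : ℕ → ℤ) (j : ℕ) :
    downCount ω j = ∑ i ∈ Finset.range j, if ω (i + 1) = ω i - 1 then 1 else 0 := by
  unfold downCount
  rw [Finset.card_filter]
  induction j with
  | zero => simp
  | succ j ih => rw [Finset.sum_Icc_succ_top (by omega), ih, Finset.sum_range_succ]; rfl

lemma downCount_zero (ω : ℕ → ℤ) : downCount ω 0 = 0 := rfl

lemma downCount_pathCons_succ (x : ℤ) (ω : ℕ → ℤ) (j : ℕ) :
    downCount (pathCons x ω) (j + 1) = downCount ω j + if ω 0 = x - 1 then 1 else 0 := by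
  rw [downCount_eq_sum, downCount_eq_sum, Finset.sum_range_succ']
  rfl

/-- The time of the `n`-th down-step of `ω`, with value `0` for `n = 0`. -/
def downTime (ω : ℕ → ℤ) (n : ℕ) : ℕ := sInf {j | downCount ω j = n}

lemma betaTime_eq_downTime (ω : ℕ → ℤ) {n : ℕ} (hn : 1 ≤ n) : betaTime ω n = downTime ω n := by
  unfold betaTime downTime
  congr 1
  ext j
  simp only [Set.mem_ofPred_eq, and_iff_right_iff_imp]
  rintro h
  rcases Nat.eq_zero_or_pos j with rfl | hj
  · rw [downCount_zero] at h
    omega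
  · exact hj

open Classical in
/-- The value of `f` at the position of `ω` right after the `n`-th down-step, or `0` if `ω` has
fewer than `n` down-steps. -/
def downValue (f : ℤ → ℝ) (n : ℕ) (ω : ℕ → ℤ) : ℝ :=
  if ∃ j, downCount ω j = n then f (ω (downTime ω n)) else 0

lemma downValue_zero (f : ℤ → ℝ) (ω : ℕ → ℤ) : downValue f 0 ω = f (ω 0) := by
  have h : downTime ω 0 = 0 := Nat.sInf_eq_zero.2 (Or.inl (downCount_zero ω))
  rw [downValue, if_pos ⟨0, downCount_zero ω⟩, h]

lemma downValue_pathCons (f : ℤ → ℝ) {m n : ℕ} {x : ℤ} {ω : ℕ → ℤ} (hm : m ≠ 0)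
    (h : ∀ j, downCount (pathCons x ω) (j + 1) = m ↔ downCount ω j = n) :
    downValue f m (pathCons x ω) = downValue f n ω := by
  by_cases hex : ∃ j, downCount ω j = n
  · obtain ⟨j, hj⟩ := hex
    have ht : downTime (pathCons x ω) m = downTime ω n + 1 := by
      refine le_antisymm (Nat.sInf_le ((h _).2 (Nat.sInf_mem (s := {j | downCount ω j = n})
        ⟨j, hj⟩))) ?_
      have hmem : downCount (pathCons x ω) (downTime (pathCons x ω) m) = m :=
        Nat.sInf_mem (s := {j | downCount (pathCons x ω) j = m}) ⟨j + 1, (h j).2 hj⟩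
      cases hd : downTime (pathCons x ω) m with
      | zero =>
        rw [hd, downCount_zero] at hmem
        exact absurd hmem.symm hm
      | succ k =>
        rw [hd] at hmem
        exact Nat.succ_le_succ (Nat.sInf_le ((h k).1 hmem))
    rw [downValue, downValue, if_pos ⟨j + 1, (h j).2 hj⟩, if_pos ⟨j, hj⟩, ht]
    rfl
  · have hex' : ¬∃ j, downCount (pathCons x ω) j = m := by
      rintro ⟨j, hj⟩
      cases j with
      | zero => exact hm hj.symm
      | succ j => exact hex ⟨j, (h j).1 hj⟩
    rw [downValue, downValue, if_neg hex', if_neg hex]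

lemma downValue_pathCons_of_down (f : ℤ → ℝ) (n : ℕ) {x : ℤ} {ω : ℕ → ℤ} (h : ω 0 = x - 1) :
    downValue f (n + 1) (pathCons x ω) = downValue f n ω :=
  downValue_pathCons f n.succ_ne_zero fun j => by simp [downCount_pathCons_succ, h]

lemma downValue_pathCons_of_up (f : ℤ → ℝ) (n : ℕ) {x : ℤ} {ω : ℕ → ℤ} (h : ω 0 = x + 1) :
    downValue f (n + 1) (pathCons x ω) = downValue f (n + 1) ω :=
  downValue_pathCons f n.succ_ne_zero fun j => by
    rw [downCount_pathCons_succ, if_neg (by omega), add_zero]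

lemma abs_downValue_le {f : ℤ → ℝ} {B : ℝ} (hf : ∀ x, |f x| ≤ B) (n : ℕ) (ω : ℕ → ℤ) :
    |downValue f n ω| ≤ B := by
  unfold downValue
  split_ifs
  · exact hf _
  · rw [abs_zero]
    exact (abs_nonneg _).trans (hf 0)

lemma measurableSet_downCount_eq (j n : ℕ) : MeasurableSet {ω | downCount ω j = n} := by
  have : Measurable fun ω => downCount ω j := by
    simp only [downCount_eq_sum]
    refine Finset.measurable_sum _ fun i _ => Measurable.ite ?_ measurable_const measurable_const
    exact measurableSet_eq_fun (measurable_pi_apply _)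
      ((measurable_pi_apply (X := fun _ : ℕ => ℤ) i).sub_const 1)
  exact this (measurableSet_singleton n)

lemma measurableSet_exists_downCount_eq (n : ℕ) :
    MeasurableSet {ω | ∃ j, downCount ω j = n} := by
  rw [Set.ofPred_exists]
  exact MeasurableSet.iUnion fun j => measurableSet_downCount_eq j n

lemma measurable_downTime (n : ℕ) : Measurable fun ω => downTime ω n := by
  refine measurable_of_Iic fun m => ?_
  have : (fun ω => downTime ω n) ⁻¹' Set.Iic m =
      (⋃ j ∈ Set.Iic m, {ω | downCount ω j = n}) ∪ {ω | ∃ j, downCount ω j = n}ᶜ := by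
    ext ω
    simp only [Set.mem_preimage, Set.mem_Iic, Set.mem_union, Set.mem_iUnion, Set.mem_ofPred_eq,
      Set.mem_compl_iff, exists_prop]
    constructor
    · intro h
      by_cases hex : ∃ j, downCount ω j = n
      · exact Or.inl ⟨_, h, Nat.sInf_mem (s := {j | downCount ω j = n}) hex⟩
      · exact Or.inr hex
    · rintro (⟨j, hj, h⟩ | h)
      · exact (Nat.sInf_le (s := {j | downCount ω j = n}) h).trans hj
      · have : {j | downCount ω j = n} = ∅ := Set.eq_empty_of_forall_notMem fun j hj => h ⟨j, hj⟩
        simp [downTime, this]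
  rw [this]
  exact (MeasurableSet.biUnion (Set.to_countable _) fun j _ =>
    measurableSet_downCount_eq j n).union (measurableSet_exists_downCount_eq n).compl

lemma measurable_apply_downTime (n : ℕ) : Measurable fun ω : ℕ → ℤ => ω (downTime ω n) := by
  have : Measurable fun p : (ℕ → ℤ) × ℕ => p.1 p.2 :=
    measurable_from_prod_countable_left fun k => measurable_pi_apply k
  exact this.comp (measurable_id.prodMk (measurable_downTime n))

lemma measurable_downValue (f : ℤ → ℝ) (n : ℕ) : Measurable (downValue f n) := by
  classical
  have h : Measurable fun ω : ℕ → ℤ => f (ω (downTime ω n)) :=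
    (measurable_of_countable f).comp (measurable_apply_downTime n)
  unfold downValue
  exact Measurable.ite (measurableSet_exists_downCount_eq n) h measurable_const

/-- The cylinder sets that prescribe an initial segment of the path. -/
def initialCylinders : Set (Set (ℕ → ℤ)) :=
  {s | ∃ (n : ℕ) (p : ℕ → ℤ), s = {ω | ∀ i ≤ n, ω i = p i}}

lemma measurableSet_initialCylinder (n : ℕ) (p : ℕ → ℤ) :
    MeasurableSet {ω : ℕ → ℤ | ∀ i ≤ n, ω i = p i} := by
  simp only [Set.ofPred_forall]
  exact MeasurableSet.iInter fun i => MeasurableSet.iInter fun _ =>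
    measurable_pi_apply (X := fun _ : ℕ => ℤ) i (measurableSet_singleton (p i))

lemma isPiSystem_initialCylinders : IsPiSystem initialCylinders := by
  rintro _ ⟨n, p, rfl⟩ _ ⟨m, q, rfl⟩ ⟨η, h1, h2⟩
  refine ⟨max n m, η, ?_⟩
  ext ω
  constructor
  · rintro ⟨a, b⟩ i hi
    rcases le_max_iff.1 hi with h | h
    · rw [a i h, h1 i h]
    · rw [b i h, h2 i h]
  · intro a
    exact ⟨fun i hi => (a i (le_max_of_le_left hi)).trans (h1 i hi),
      fun i hi => (a i (le_max_of_le_right hi)).trans (h2 i hi)⟩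

lemma generateFrom_initialCylinders :
    (inferInstance : MeasurableSpace (ℕ → ℤ)) =
      MeasurableSpace.generateFrom initialCylinders := by
  refine le_antisymm (iSup_le fun n => ?_) (MeasurableSpace.generateFrom_le ?_)
  · rw [← measurable_iff_comap_le]
    refine @measurable_to_countable' _ _ _ _ (MeasurableSpace.generateFrom initialCylinders) _
      fun k => ?_
    have : (fun ω : ℕ → ℤ => ω n) ⁻¹' {k} = ⋃ p ∈ {p : Fin (n + 1) → ℤ | p (Fin.last n) = k},
        {ω : ℕ → ℤ | ∀ i ≤ n, ω i = if h : i < n + 1 then p ⟨i, h⟩ else 0} := by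
      ext ω
      simp only [Set.mem_preimage, Set.mem_singleton_iff, Set.mem_ofPred_eq, Set.mem_iUnion,
        exists_prop]
      constructor
      · intro h
        exact ⟨fun i => ω i, h, fun i hi => by rw [dif_pos (by omega)]⟩
      · rintro ⟨p, hp, h⟩
        rw [h n le_rfl, dif_pos n.lt_succ_self, ← hp]
        rfl
    rw [this]
    exact MeasurableSet.biUnion (Set.to_countable _) fun p _ =>
      MeasurableSpace.measurableSet_generateFrom ⟨n, _, rfl⟩
  · rintro _ ⟨n, p, rfl⟩
    exact measurableSet_initialCylinder n p

lemma pathCons_preimage_cylinder_zero (x : ℤ) (p : ℕ → ℤ) :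
    pathCons x ⁻¹' {ω | ∀ i ≤ 0, ω i = p i} = if p 0 = x then Set.univ else ∅ := by
  ext ω
  split_ifs with h <;> simp [pathCons, h, eq_comm]

lemma pathCons_preimage_cylinder_succ (x : ℤ) (n : ℕ) (p : ℕ → ℤ) :
    pathCons x ⁻¹' {ω | ∀ i ≤ n + 1, ω i = p i} =
      if p 0 = x then {ω | ∀ i ≤ n, ω i = p (i + 1)} else ∅ := by
  ext ω
  split_ifs with h
  · simp only [Set.mem_preimage, Set.mem_ofPred_eq]
    constructor
    · intro a i hi
      exact a (i + 1) (by omega)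
    · intro a i hi
      cases i with
      | zero => exact h.symm
      | succ i => exact a i (by omega)
  · simp only [Set.mem_preimage, Set.mem_ofPred_eq, Set.mem_empty_iff_false, iff_false]
    intro a
    exact h (a 0 (Nat.zero_le _)).symm

lemma urnStep_eq (lam : ℝ) (x y : ℤ) :
    urnStep lam x y = 1 / (1 + urnRatio lam x) * (if y = x - 1 then 1 else 0) +
      urnRatio lam x / (1 + urnRatio lam x) * (if y = x + 1 then 1 else 0) := by
  unfold urnStep urnRatio
  by_cases h : y = x + 1
  · rw [if_pos h, if_pos h, if_neg (by omega)]
    ring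
  · rw [if_neg h, if_neg h]
    split_ifs <;> ring

/-- The Markov property of the urn chain at time one. -/
lemma IsUrnChain.eq_firstStep {lam : ℝ} (h0 : 0 < lam) {P : ℤ → Measure (ℕ → ℤ)}
    (hP : IsUrnChain lam P) (x : ℤ) :
    P x = ENNReal.ofReal (1 / (1 + urnRatio lam x)) • (P (x - 1)).map (pathCons x) +
      ENNReal.ofReal (urnRatio lam x / (1 + urnRatio lam x)) • (P (x + 1)).map (pathCons x) := by
  have := hP.1
  have hr := urnRatio_pos h0 x
  have hd : 0 ≤ 1 / (1 + urnRatio lam x) := by positivity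
  have hu : 0 ≤ urnRatio lam x / (1 + urnRatio lam x) := by positivity
  have hsum : 1 / (1 + urnRatio lam x) + urnRatio lam x / (1 + urnRatio lam x) = 1 := by
    field_simp
  refine ext_of_generate_finite initialCylinders generateFrom_initialCylinders
    isPiSystem_initialCylinders ?_ ?_
  · rintro _ ⟨n, p, rfl⟩
    rw [← ENNReal.toReal_eq_toReal_iff' (measure_ne_top _ _) (by
        rw [Measure.add_apply, Measure.smul_apply, Measure.smul_apply,
          Measure.map_apply (measurable_pathCons x) (measurableSet_initialCylinder n p),
          Measure.map_apply (measurable_pathCons x) (measurableSet_initialCylinder n p),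
          smul_eq_mul, smul_eq_mul]
        finiteness),
      Measure.add_apply, Measure.smul_apply, Measure.smul_apply,
      Measure.map_apply (measurable_pathCons x) (measurableSet_initialCylinder n p),
      Measure.map_apply (measurable_pathCons x) (measurableSet_initialCylinder n p),
      smul_eq_mul, smul_eq_mul, ENNReal.toReal_add (by finiteness) (by finiteness),
      ENNReal.toReal_mul, ENNReal.toReal_mul, ENNReal.toReal_ofReal hd, ENNReal.toReal_ofReal hu,
      hP.2]
    cases n with
    | zero =>
      rw [pathCons_preimage_cylinder_zero]
      split_ifs
      · simpa using hsum.symm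
      · simp
    | succ n =>
      rw [pathCons_preimage_cylinder_succ, Finset.prod_range_succ']
      split_ifs with h
      · rw [hP.2 _ n fun i => p (i + 1), hP.2 _ n fun i => p (i + 1), h, urnStep_eq]
        ring
      · simp
  · rw [Measure.add_apply, Measure.smul_apply, Measure.smul_apply,
      Measure.map_apply (measurable_pathCons x) MeasurableSet.univ,
      Measure.map_apply (measurable_pathCons x) MeasurableSet.univ]
    simp only [Set.preimage_univ, measure_univ, smul_eq_mul, mul_one]
    rw [← ENNReal.ofReal_add hd hu, hsum, ENNReal.ofReal_one]

lemma IsUrnChain.ae_apply_zero {lam : ℝ} {P : ℤ → Measure (ℕ → ℤ)} (hP : IsUrnChain lam P)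
    (x : ℤ) : ∀ᵐ ω ∂P x, ω 0 = x := by
  have := hP.1 x
  have h := hP.2 x 0 fun _ => x
  rw [if_pos rfl, Finset.prod_range_zero, mul_one, ENNReal.toReal_eq_one_iff] at h
  filter_upwards [(mem_ae_iff_prob_eq_one (measurableSet_initialCylinder 0 fun _ => x)).2 h]
    with ω hω using hω 0 le_rfl

/-- The first-step equation for the law of the position after the `n`-th down-step. -/
lemma IsUrnChain.integral_downValue_firstStep {lam : ℝ} (h0 : 0 < lam) {P : ℤ → Measure (ℕ → ℤ)}
    (hP : IsUrnChain lam P) {f : ℤ → ℝ} {B : ℝ} (hf : ∀ x, |f x| ≤ B) (n : ℕ) (x : ℤ) :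
    (1 + urnRatio lam x) * ∫ ω, downValue f (n + 1) ω ∂P x =
      ∫ ω, downValue f n ω ∂P (x - 1) +
        urnRatio lam x * ∫ ω, downValue f (n + 1) ω ∂P (x + 1) := by
  have := hP.1
  have hr := urnRatio_pos h0 x
  have hm := measurable_downValue f (n + 1)
  have hint : ∀ μ : Measure (ℕ → ℤ), IsFiniteMeasure μ → Integrable (downValue f (n + 1)) μ :=
    fun μ _ => Integrable.of_bound hm.aestronglyMeasurable B
      (Eventually.of_forall fun ω => abs_downValue_le hf _ ω)
  have e : ∫ ω, downValue f (n + 1) ω ∂P x =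
      1 / (1 + urnRatio lam x) * ∫ ω, downValue f n ω ∂P (x - 1) +
        urnRatio lam x / (1 + urnRatio lam x) * ∫ ω, downValue f (n + 1) ω ∂P (x + 1) := by
    rw [hP.eq_firstStep h0 x, integral_add_measure
        ((hint _ inferInstance).smul_measure ENNReal.ofReal_ne_top)
        ((hint _ inferInstance).smul_measure ENNReal.ofReal_ne_top),
      integral_smul_measure, integral_smul_measure,
      integral_map (measurable_pathCons x).aemeasurable hm.aestronglyMeasurable,
      integral_map (measurable_pathCons x).aemeasurable hm.aestronglyMeasurable,
      ENNReal.toReal_ofReal (by positivity), ENNReal.toReal_ofReal (by positivity), smul_eq_mul,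
      smul_eq_mul]
    congr 2
    · refine integral_congr_ae ?_
      filter_upwards [hP.ae_apply_zero (x - 1)] with ω hω
      exact downValue_pathCons_of_down f n hω
    · refine integral_congr_ae ?_
      filter_upwards [hP.ae_apply_zero (x + 1)] with ω hω
      exact downValue_pathCons_of_up f n hω
  rw [e]
  field_simp

lemma IsUrnChain.integral_downValue_zero {lam : ℝ} {P : ℤ → Measure (ℕ → ℤ)}
    (hP : IsUrnChain lam P) (f : ℤ → ℝ) (x : ℤ) : ∫ ω, downValue f 0 ω ∂P x = f x := by
  have := hP.1 x
  have : ∫ ω, downValue f 0 ω ∂P x = ∫ _, f x ∂P x := by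
    refine integral_congr_ae ?_
    filter_upwards [hP.ae_apply_zero x] with ω hω
    rw [downValue_zero, hω]
  simp [this]

lemma IsUrnChain.abs_integral_downValue_sub_le {lam : ℝ} (h0 : 0 < lam) (h1 : lam < 1)
    {P : ℤ → Measure (ℕ → ℤ)} (hP : IsUrnChain lam P) {f : ℤ → ℝ} {B L : ℝ} (hL : 0 ≤ L)
    (hf : ∀ x, |f x| ≤ B) (hfL : ∀ x, |f (x + 1) - f x| ≤ L) (n : ℕ) (j : ℤ) :
    |∫ ω, downValue f n ω ∂P j - ∑' x, urnPi lam x * f x| ≤ L * ((1 + lam ^ 2) / 2) ^ n *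
      (|urnPotential lam j| + ∑' x, urnPi lam x * |urnPotential lam x|) := by
  have := hP.1
  have := abs_sub_tsum_urnPi_le h0 h1 (G := fun n x => ∫ ω, downValue f n ω ∂P x) (B := B) hL
    (fun n x => by
      simpa using norm_integral_le_of_norm_le_const (μ := P x)
        (f := downValue f n) (Eventually.of_forall fun ω => abs_downValue_le hf n ω))
    (hP.integral_downValue_firstStep h0 hf)
    (fun x => by simpa only [hP.integral_downValue_zero] using hfL x) n j
  simpa only [hP.integral_downValue_zero] using this

lemma IsUrnChain.ae_exists_downCount_eq {lam : ℝ} (h0 : 0 < lam) (h1 : lam < 1)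
    {P : ℤ → Measure (ℕ → ℤ)} (hP : IsUrnChain lam P) (n : ℕ) (j : ℤ) :
    ∀ᵐ ω ∂P j, ∃ i, downCount ω i = n := by
  have := hP.1 j
  have h := hP.abs_integral_downValue_sub_le h0 h1 (f := fun _ => 1) (B := 1) (L := 0) le_rfl
    (by simp) (by simp) n j
  simp only [mul_one, (hasSum_urnPi h0 h1).tsum_eq, zero_mul] at h
  have e : downValue (fun _ => 1) n = {ω | ∃ i, downCount ω i = n}.indicator 1 := by
    ext ω
    simp only [downValue, Set.indicator, Set.mem_ofPred_eq, Pi.one_apply]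
  have h' : ∫ ω, downValue (fun _ => 1) n ω ∂P j = 1 :=
    sub_eq_zero.1 (abs_eq_zero.1 (le_antisymm h (abs_nonneg _)))
  rw [e, integral_indicator_one (measurableSet_exists_downCount_eq n), measureReal_def,
    ENNReal.toReal_eq_one_iff] at h'
  exact (mem_ae_iff_prob_eq_one (measurableSet_exists_downCount_eq n)).2 h'

/-- Exponential convergence of the law of `𝔇_{β_n}` to `π` in total variation, with a
constant `M(j)` depending on the starting point `j` satisfying `Σ_k π(k) M(k) < ∞`. -/
theorem urn_tv_bound_M (lam : ℝ) (hlam : lam ∈ Set.Ioo (0 : ℝ) 1)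
    (P : ℤ → Measure (ℕ → ℤ)) (hP : IsUrnChain lam P) :
    ∃ C₂ > (0 : ℝ), ∃ M : ℤ → ℝ, (∀ j, 0 < M j) ∧
      (Summable fun k : ℤ => urnPi lam k * M k) ∧
      ∀ (j : ℤ) (n : ℕ), 1 ≤ n →
        ∑' k : ℤ,
            ENNReal.ofReal |(P j {ω | ω (betaTime ω n) = k}).toReal - urnPi lam k| ≤
          ENNReal.ofReal (M j * Real.exp (-C₂ * (n : ℝ))) := by
  obtain ⟨h0, h1⟩ := hlam
  have := hP.1
  set S := ∑' x, urnPi lam x * |urnPotential lam x| with hS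
  have hS0 : 0 ≤ S := tsum_nonneg fun x => mul_nonneg (urnPi_pos h0 h1 x).le (abs_nonneg _)
  have hρ0 : 0 < (1 + lam ^ 2) / 2 := by positivity
  have hρ1 : (1 + lam ^ 2) / 2 < 1 := by nlinarith
  have hπ := hasSum_urnPi h0 h1
  refine ⟨-Real.log ((1 + lam ^ 2) / 2), neg_pos.2 (Real.log_neg hρ0 hρ1),
    fun j => 2 * (|urnPotential lam j| + S) + 1, fun j => by positivity, ?_, fun j n hn => ?_⟩
  · refine (((summable_urnPi_mul_abs_urnPotential h0 h1).mul_left 2).add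
      (hπ.summable.mul_right (2 * S + 1))).congr fun x => ?_
    ring
  have hexp : Real.exp (- -Real.log ((1 + lam ^ 2) / 2) * n) = ((1 + lam ^ 2) / 2) ^ n := by
    rw [neg_neg, mul_comm, Real.exp_nat_mul, Real.exp_log hρ0]
  rw [hexp]
  set X : (ℕ → ℤ) → ℤ := fun ω => ω (betaTime ω n) with hX
  have hXm : Measurable X := by
    simpa only [hX, betaTime_eq_downTime _ hn] using measurable_apply_downTime n
  have hν : IsProbabilityMeasure ((P j).map X) := Measure.isProbabilityMeasure_map hXm.aemeasurable
  have hlaw : ∀ k, (P j {ω | ω (betaTime ω n) = k}).toReal = ((P j).map X).real {k} := fun k => by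
    rw [measureReal_def, Measure.map_apply hXm (measurableSet_singleton k)]
    rfl
  simp only [hlaw]
  set a : ℤ → ℝ := fun k => ((P j).map X).real {k} with ha
  have hsa : Summable a := by
    refine ENNReal.summable_toReal ?_
    have := Measure.tsum_indicator_apply_singleton ((P j).map X) Set.univ MeasurableSet.univ
    simp only [Set.indicator_univ] at this
    rw [this]
    finiteness
  set s : ℤ → ℝ := fun k => if urnPi lam k ≤ a k then 1 else -1 with hs
  have hs1 : ∀ k, |s k| ≤ 1 := fun k => by
    simp only [hs]
    split_ifs <;> simp
  have habs : ∀ k, |a k - urnPi lam k| = a k * s k - urnPi lam k * s k := fun k => by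
    simp only [hs]
    split_ifs with h
    · rw [abs_of_nonneg (by linarith)]
      ring
    · rw [abs_of_neg (by linarith)]
      ring
  have hint : ∑' k, a k * s k = ∫ ω, downValue s n ω ∂P j := by
    have hsint : Integrable s ((P j).map X) :=
      Integrable.of_bound (measurable_of_countable s).aestronglyMeasurable 1
        (Eventually.of_forall hs1)
    have := integral_countable hsint
    simp only [smul_eq_mul] at this
    rw [← this, integral_map hXm.aemeasurable (measurable_of_countable s).aestronglyMeasurable]
    refine integral_congr_ae ?_
    filter_upwards [hP.ae_exists_downCount_eq h0 h1 n j] with ω hω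
    rw [downValue, if_pos hω]
    simp only [hX, betaTime_eq_downTime _ hn]
  have hsas : Summable fun k => a k * s k :=
    Summable.of_norm_bounded hsa fun k => by
      rw [Real.norm_eq_abs, abs_mul, abs_of_nonneg measureReal_nonneg]
      exact mul_le_of_le_one_right measureReal_nonneg (hs1 k)
  have hsπ := summable_urnPi_mul h0 h1 hs1
  rw [← ENNReal.ofReal_tsum_of_nonneg (fun _ => abs_nonneg _) (hsa.sub hπ.summable).abs]
  refine ENNReal.ofReal_le_ofReal ?_
  rw [tsum_congr habs, hsas.tsum_sub hsπ, hint]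
  refine (le_abs_self _).trans ((hP.abs_integral_downValue_sub_le h0 h1 zero_le_two hs1
    (fun x => ?_) n j).trans ?_)
  · linarith [abs_sub (s (x + 1)) (s x), hs1 (x + 1), hs1 x]
  · rw [← hS]
    nlinarith [pow_pos hρ0 n]
end
end

section
/- For all i, j ∈ ℤ and all n ≥ 1, P_i(𝔇_{β_n} = j) ≤ π(j)/π(i). -/
open MeasureTheory Filter ProbabilityTheory

noncomputable section

lemma zpow_sq_eq_mul {lam : ℝ} (h0 : 0 < lam) (x : ℤ) :
    lam ^ (x ^ 2) = lam ^ ((x - 1) ^ 2) * lam ^ (2 * x - 1) := by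
  rw [← zpow_add₀ h0.ne']
  congr 1
  ring

lemma urnStep_up_mul {lam : ℝ} (h0 : 0 < lam) (x : ℤ) :
    urnStep lam x (x + 1) * (lam ^ (x ^ 2) + lam ^ ((x - 1) ^ 2)) = lam ^ (x ^ 2) := by
  have h : 0 < lam ^ (2 * x - 1) := zpow_pos h0 _
  rw [urnStep, if_pos rfl, zpow_sq_eq_mul h0 x]
  field_simp
  ring

lemma urnStep_down_mul {lam : ℝ} (h0 : 0 < lam) (x : ℤ) :
    urnStep lam x (x - 1) * (lam ^ (x ^ 2) + lam ^ ((x - 1) ^ 2)) = lam ^ ((x - 1) ^ 2) := by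
  have h : 0 < lam ^ (2 * x - 1) := zpow_pos h0 _
  rw [urnStep, if_neg (by omega), if_pos rfl, zpow_sq_eq_mul h0 x]
  field_simp
  ring

lemma urnStep_nonneg {lam : ℝ} (h0 : 0 < lam) (x y : ℤ) : 0 ≤ urnStep lam x y := by
  unfold urnStep
  split_ifs <;> positivity

lemma summable_zpow_sq_s5 {lam : ℝ} (hlam : lam ∈ Set.Ioo (0 : ℝ) 1) :
    Summable fun y : ℤ => lam ^ (y ^ 2) := by
  have key : Summable fun n : ℕ => lam ^ ((n : ℤ) ^ 2) := by
    refine Summable.of_nonneg_of_le (fun n => (zpow_pos hlam.1 _).le) (fun n => ?_)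
      (summable_geometric_of_lt_one hlam.1.le hlam.2)
    rw [← zpow_natCast]
    refine zpow_le_zpow_right_of_le_one₀ hlam.1 hlam.2.le ?_
    exact_mod_cast Nat.le_self_pow two_ne_zero n
  exact Summable.of_nat_of_neg key (by simpa using key)

lemma urnPi_div_urnPi {lam : ℝ} (hlam : lam ∈ Set.Ioo (0 : ℝ) 1) (i j : ℤ) :
    urnPi lam j / urnPi lam i = lam ^ (j ^ 2) / lam ^ (i ^ 2) :=
  div_div_div_cancel_right₀
    ((summable_zpow_sq_s5 hlam).tsum_pos (fun _ => (zpow_pos hlam.1 _).le) 0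
      (zpow_pos hlam.1 _)).ne' _ _

lemma measurableSet_coord_eq (n : ℕ) (x : ℤ) : MeasurableSet {ω : ℕ → ℤ | ω n = x} :=
  measurableSet_eq_fun (measurable_pi_apply n) measurable_const

lemma measure_eq_tsum_prefix (μ : Measure (ℕ → ℤ)) (n : ℕ) {A : Set (ℕ → ℤ)}
    (hA : MeasurableSet A) :
    μ A = ∑' c : Fin (n + 1) → ℤ, μ {ω | ω ∈ A ∧ ∀ k : Fin (n + 1), ω k = c k} := by
  rw [← measure_iUnion]
  · congr 1
    ext ω
    simp only [Set.mem_iUnion, Set.mem_ofPred_eq]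
    exact ⟨fun h => ⟨fun k => ω k, h, fun _ => rfl⟩, fun ⟨_, h, _⟩ => h⟩
  · intro c d hcd
    refine Set.disjoint_left.2 fun ω hc hd => hcd ?_
    ext k
    rw [← hc.2 k, hd.2 k]
  · intro c
    have hc : MeasurableSet {ω : ℕ → ℤ | ∀ k : Fin (n + 1), ω k = c k} := by
      rw [Set.ofPred_forall]
      exact .iInter fun k => measurableSet_coord_eq k (c k)
    exact hA.inter hc

namespace IsUrnChain

variable {lam : ℝ} {P : ℤ → Measure (ℕ → ℤ)}

lemma measure_cylinder_succ (h0 : 0 < lam) (hP : IsUrnChain lam P) (i : ℤ) (n : ℕ) (p : ℕ → ℤ) :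
    P i {ω | ∀ k ≤ n + 1, ω k = p k} =
      P i {ω | ∀ k ≤ n, ω k = p k} * ENNReal.ofReal (urnStep lam (p n) (p (n + 1))) := by
  have := hP.1 i
  rw [← ENNReal.toReal_eq_toReal_iff' (measure_ne_top _ _)
    (ENNReal.mul_ne_top (measure_ne_top _ _) ENNReal.ofReal_ne_top), ENNReal.toReal_mul,
    ENNReal.toReal_ofReal (urnStep_nonneg h0 _ _), hP.2, hP.2, Finset.prod_range_succ, mul_assoc]

/-- The one-step Markov property of the urn chain. -/
lemma measure_step (h0 : 0 < lam) (hP : IsUrnChain lam P) (i : ℤ) (n : ℕ) (x y : ℤ) :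
    P i {ω | ω n = x ∧ ω (n + 1) = y} =
      P i {ω | ω n = x} * ENNReal.ofReal (urnStep lam x y) := by
  rw [measure_eq_tsum_prefix (P i) n (A := {ω | ω n = x ∧ ω (n + 1) = y})
      ((measurableSet_coord_eq n x).inter (measurableSet_coord_eq (n + 1) y)),
    measure_eq_tsum_prefix (P i) n (measurableSet_coord_eq n x), ← ENNReal.tsum_mul_right]
  refine tsum_congr fun c => ?_
  by_cases hc : c (Fin.last n) = x
  · let p : ℕ → ℤ := fun k => if h : k < n + 1 then c ⟨k, h⟩ else y
    have hp (k : Fin (n + 1)) : p k = c k := dif_pos k.2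
    have hpn : p n = x := by rw [← hc, ← hp]; rfl
    have hpn' : p (n + 1) = y := by simp [p]
    have h1 : {ω : ℕ → ℤ | ω ∈ {ω : ℕ → ℤ | ω n = x ∧ ω (n + 1) = y} ∧
        ∀ k : Fin (n + 1), ω k = c k} = {ω | ∀ k ≤ n + 1, ω k = p k} := by
      ext ω
      constructor
      · rintro ⟨⟨_, hy⟩, h⟩ k hk
        rcases hk.lt_or_eq with hk | rfl
        · exact (h ⟨k, hk⟩).trans (hp ⟨k, hk⟩).symm
        · rw [hy, hpn']
      · intro h
        exact ⟨⟨(h n (by omega)).trans hpn, (h _ le_rfl).trans hpn'⟩,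
          fun k => (h k (by omega)).trans (hp k)⟩
    have h2 : {ω : ℕ → ℤ | ω ∈ {ω : ℕ → ℤ | ω n = x} ∧
        ∀ k : Fin (n + 1), ω k = c k} = {ω | ∀ k ≤ n, ω k = p k} := by
      ext ω
      constructor
      · rintro ⟨_, h⟩ k hk
        exact (h ⟨k, by omega⟩).trans (hp ⟨k, by omega⟩).symm
      · intro h
        exact ⟨(h n le_rfl).trans hpn, fun k => (h k (by omega)).trans (hp k)⟩
    rw [h1, h2, measure_cylinder_succ h0 hP, hpn, hpn']
  · have hne (ω : ℕ → ℤ) (hx : ω n = x) : ¬ ∀ k : Fin (n + 1), ω k = c k :=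
      fun h => hc ((h (Fin.last n)).symm.trans hx)
    have h1 : {ω : ℕ → ℤ | ω ∈ {ω : ℕ → ℤ | ω n = x ∧ ω (n + 1) = y} ∧
        ∀ k : Fin (n + 1), ω k = c k} = ∅ :=
      Set.eq_empty_of_forall_notMem fun ω h => hne ω h.1.1 h.2
    have h2 : {ω : ℕ → ℤ | ω ∈ {ω : ℕ → ℤ | ω n = x} ∧
        ∀ k : Fin (n + 1), ω k = c k} = ∅ :=
      Set.eq_empty_of_forall_notMem fun ω h => hne ω h.1 h.2
    rw [h1, h2]
    simp

lemma ae_start (hP : IsUrnChain lam P) (i : ℤ) : ∀ᵐ ω ∂P i, ω 0 = i := by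
  have := hP.1 i
  have h := hP.2 i 0 fun _ => i
  simp only [Nat.le_zero, forall_eq, if_true, Finset.range_zero, Finset.prod_empty, mul_one] at h
  refine (mem_ae_iff_prob_eq_one (measurableSet_coord_eq 0 i)).2 ?_
  exact (ENNReal.toReal_eq_one_iff _).1 h

lemma ae_nearest_neighbor (h0 : 0 < lam) (hP : IsUrnChain lam P) (i : ℤ) :
    ∀ᵐ ω ∂P i, ∀ n, ω (n + 1) = ω n + 1 ∨ ω (n + 1) = ω n - 1 := by
  have key : ∀ᵐ ω ∂P i, ∀ n x y, urnStep lam x y = 0 → ¬ (ω n = x ∧ ω (n + 1) = y) := by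
    simp only [ae_all_iff]
    intro n x y h
    simp only [ae_iff, not_not, measure_step h0 hP, h, ENNReal.ofReal_zero, mul_zero]
  filter_upwards [key] with ω hω n
  by_contra! h
  exact hω n _ _ (by rw [urnStep, if_neg h.1, if_neg h.2]) ⟨rfl, rfl⟩

/-- Reversibility of `x ↦ lam ^ x² + lam ^ (x - 1)²` bounds the marginals of the chain. -/
lemma measure_coord_le (h0 : 0 < lam) (hP : IsUrnChain lam P) (i : ℤ) (n : ℕ) (x : ℤ) :
    P i {ω | ω n = x} ≤ ENNReal.ofReal
      ((lam ^ (x ^ 2) + lam ^ ((x - 1) ^ 2)) / (lam ^ (i ^ 2) + lam ^ ((i - 1) ^ 2))) := by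
  have := hP.1 i
  have hpos (z : ℤ) : 0 < lam ^ (z ^ 2) := zpow_pos h0 _
  have hi : 0 < lam ^ (i ^ 2) + lam ^ ((i - 1) ^ 2) := add_pos (hpos _) (hpos _)
  induction n generalizing x with
  | zero =>
    by_cases hx : x = i
    · subst hx
      rw [div_self hi.ne', ENNReal.ofReal_one]
      exact prob_le_one
    · have : P i {ω | ω 0 = x} = 0 :=
        measure_mono_null (fun ω (h : ω 0 = x) (h' : ω 0 = i) => hx (h.symm.trans h'))
          (ae_iff.1 (ae_start hP i))
      rw [this]
      exact zero_le
  | succ n ih =>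
    have hle : P i {ω | ω (n + 1) = x} ≤
        P i ({ω | ω n = x - 1 ∧ ω (n + 1) = x} ∪ {ω | ω n = x + 1 ∧ ω (n + 1) = x}) := by
      refine measure_mono_ae ?_
      filter_upwards [ae_nearest_neighbor h0 hP i] with ω hω (hx : ω (n + 1) = x)
      rcases hω n with h | h
      · exact Or.inl ⟨by omega, hx⟩
      · exact Or.inr ⟨by omega, hx⟩
    refine (hle.trans (measure_union_le _ _)).trans ?_
    rw [measure_step h0 hP, measure_step h0 hP]
    refine (add_le_add (mul_le_mul_left (ih _) _) (mul_le_mul_left (ih _) _)).trans_eq ?_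
    have hup := urnStep_up_mul h0 (x - 1)
    have hdown := urnStep_down_mul h0 (x + 1)
    rw [sub_add_cancel] at hup
    rw [add_sub_cancel_right] at hdown ⊢
    have hm (z : ℤ) : 0 ≤ (lam ^ (z ^ 2) + lam ^ ((z - 1) ^ 2)) /
        (lam ^ (i ^ 2) + lam ^ ((i - 1) ^ 2)) :=
      (div_pos (add_pos (hpos _) (hpos _)) hi).le
    have hm' := hm (x + 1)
    rw [add_sub_cancel_right] at hm'
    rw [← ENNReal.ofReal_mul (hm _), ← ENNReal.ofReal_mul hm',
      ← ENNReal.ofReal_add (mul_nonneg (hm _) (urnStep_nonneg h0 _ _))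
        (mul_nonneg hm' (urnStep_nonneg h0 _ _))]
    congr 1
    rw [div_mul_eq_mul_div, div_mul_eq_mul_div, ← add_div, mul_comm, hup, mul_comm, hdown, add_comm]

end IsUrnChain

lemma downCount_succ (ω : ℕ → ℤ) (k : ℕ) :
    downCount ω (k + 1) = downCount ω k + if ω (k + 1) = ω k - 1 then 1 else 0 := by
  rw [downCount, downCount, ← Finset.insert_Icc_right_eq_Icc_add_one (by omega),
    Finset.filter_insert]
  split_ifs <;> simp_all

lemma coord_eq_sub_downCount {ω : ℕ → ℤ}
    (hω : ∀ n, ω (n + 1) = ω n + 1 ∨ ω (n + 1) = ω n - 1) (k : ℕ) :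
    ω k = ω 0 + k - 2 * downCount ω k := by
  induction k with
  | zero => simp [downCount]
  | succ k ih =>
    rw [downCount_succ]
    rcases hω k with h | h
    · rw [if_neg (by omega)]
      push_cast
      omega
    · rw [if_pos h]
      push_cast
      omega

/-- If a nearest-neighbour path is away from its starting point at its `n`-th down-step, then the
time of that down-step is determined by the two endpoints. -/
lemma exists_step_of_betaTime {ω : ℕ → ℤ}
    (hω : ∀ n, ω (n + 1) = ω n + 1 ∨ ω (n + 1) = ω n - 1) {n : ℕ} (hn : 1 ≤ n)
    (hne : ω (betaTime ω n) ≠ ω 0) :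
    betaTime ω n = (ω (betaTime ω n) - ω 0 + 2 * n - 1).toNat + 1 ∧
      ω (betaTime ω n - 1) = ω (betaTime ω n) + 1 := by
  have hmem : 1 ≤ betaTime ω n ∧ downCount ω (betaTime ω n) = n := by
    refine Nat.sInf_mem (s := {j | 1 ≤ j ∧ downCount ω j = n})
      (Set.nonempty_iff_ne_empty.2 fun h => hne ?_)
    rw [betaTime, h, Nat.sInf_empty]
  obtain ⟨k, hk⟩ := Nat.exists_eq_add_of_le' hmem.1
  have hmin : downCount ω k ≠ n := by
    intro h
    rcases Nat.eq_zero_or_pos k with rfl | hpos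
    · simp [downCount] at h
      omega
    · have : betaTime ω n ≤ k := Nat.sInf_le ⟨hpos, h⟩
      omega
  rw [hk] at hmem ⊢
  have hT := coord_eq_sub_downCount hω (k + 1)
  have hsucc := downCount_succ ω k
  rw [hmem.2] at hT hsucc
  refine ⟨by push_cast at hT; omega, ?_⟩
  split_ifs at hsucc with h
  · rw [Nat.add_sub_cancel]
    omega
  · omega

/-- Uniform-in-`n` bound: `P_i(𝔇_{β_n} = j) ≤ π(j)/π(i)`. -/
theorem urn_beta_pi_ratio_bound (lam : ℝ) (hlam : lam ∈ Set.Ioo (0 : ℝ) 1)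
    (P : ℤ → Measure (ℕ → ℤ)) (hP : IsUrnChain lam P) :
    ∀ (i j : ℤ) (n : ℕ), 1 ≤ n →
      (P i {ω | ω (betaTime ω n) = j}).toReal ≤ urnPi lam j / urnPi lam i := by
  intro i j n hn
  have h0 := hlam.1
  have := hP.1 i
  have hpos (z : ℤ) : 0 < lam ^ (z ^ 2) := zpow_pos h0 _
  rw [urnPi_div_urnPi hlam]
  by_cases hij : j = i
  · rw [hij, div_self (hpos i).ne']
    exact ENNReal.toReal_mono ENNReal.one_ne_top prob_le_one
  refine ENNReal.toReal_le_of_le_ofReal (div_pos (hpos j) (hpos i)).le ?_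
  have hle : P i {ω | ω (betaTime ω n) = j} ≤
      P i {ω | ω (j - i + 2 * n - 1).toNat = j + 1 ∧ ω ((j - i + 2 * n - 1).toNat + 1) = j} := by
    refine measure_mono_ae ?_
    filter_upwards [hP.ae_start i, IsUrnChain.ae_nearest_neighbor h0 hP i]
      with ω hi hω (hj : ω (betaTime ω n) = j)
    obtain ⟨hT, hdown⟩ := exists_step_of_betaTime hω hn (by rwa [hj, hi])
    rw [hj, hi] at hT
    rw [hj, hT, Nat.add_sub_cancel] at hdown
    rw [hT] at hj
    exact ⟨hdown, hj⟩
  refine hle.trans ?_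
  rw [IsUrnChain.measure_step h0 hP]
  refine (mul_le_mul_left (IsUrnChain.measure_coord_le h0 hP i _ _) _).trans ?_
  have hdown := urnStep_down_mul h0 (j + 1)
  rw [add_sub_cancel_right] at hdown ⊢
  rw [← ENNReal.ofReal_mul
    (div_pos (add_pos (hpos _) (hpos _)) (add_pos (hpos _) (hpos _))).le]
  refine ENNReal.ofReal_le_ofReal ?_
  rw [div_mul_eq_mul_div, mul_comm, hdown]
  exact div_le_div_of_nonneg_left (hpos j).le (hpos i) (le_add_of_nonneg_right (hpos _).le)
end
end
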